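/- Assume ψ satisfies (H1)–(H3), is four times differentiable on (0, ∞), and satisfies ψ'''(r) > 0 and (ψ'(r)/ψ'''(r))' ≤ 0 for every r > 0. Then for every p with (2n+1)/(2n−3) ≤ p < (n+2)/(n−2), the function G satisfies the Λ-property. -/

import Mathlib

open Real MeasureTheory Filter Set Asymptotics

noncomputable section

/-- (H1): ψ is C² on [0,∞), ψ(0) = ψ''(0) = 0, ψ'(0) = 1, ψ > 0 on (0,∞). -/
def H1 (ψ : ℝ → ℝ) : Prop :=
  ContDiffOn ℝ 2 ψ (Ici 0) ∧ ψ 0 = 0 ∧ deriv ψ 0 = 1 ∧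
    deriv (deriv ψ) 0 = 0 ∧ ∀ r > (0 : ℝ), 0 < ψ r

/-- (H2): ψ' ≥ 0 on (0,∞). -/
def H2 (ψ : ℝ → ℝ) : Prop := ∀ r > (0 : ℝ), 0 ≤ deriv ψ r

/-- (H3): liminf_{r→∞} ψ'(r)/ψ(r) > 0, i.e. ψ'/ψ is eventually bounded below
by a positive constant. -/
def H3 (ψ : ℝ → ℝ) : Prop := ∃ c > (0 : ℝ), ∀ᶠ r in atTop, c ≤ deriv ψ r / ψ r

/-- δ := 2(n-1)/(p+3). -/
def delta (n : ℕ) (p : ℝ) : ℝ := 2 * ((n : ℝ) - 1) / (p + 3)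

/-- G(r) := δ ψ(r)^{δ(p-1)-2} [ (δ+2-n) ψ'(r)² − ψ''(r) ψ(r) ]. -/
def Gfun (n : ℕ) (p : ℝ) (ψ : ℝ → ℝ) : ℝ → ℝ := fun r =>
  delta n p * ψ r ^ (delta n p * (p - 1) - 2) *
    ((delta n p + 2 - (n : ℝ)) * (deriv ψ r) ^ 2 - deriv (deriv ψ) r * ψ r)

/-- The Λ-property: there is r₁ ∈ [0,+∞] with G' ≥ 0 on (0,r₁) and G' ≤ 0 on (r₁,∞),
with G' not identically zero on (0, ∞). -/
def LambdaProperty (G : ℝ → ℝ) : Prop :=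
  ((∃ r₁ : ℝ, 0 ≤ r₁ ∧ (∀ r, 0 < r → r < r₁ → 0 ≤ deriv G r) ∧
      (∀ r, r₁ < r → deriv G r ≤ 0)) ∨
    (∀ r, 0 < r → 0 ≤ deriv G r)) ∧
  ¬ (∀ r, 0 < r → deriv G r = 0)

open scoped Topology

/-- If `f' < 0` at every zero of `f` on `(0, ∞)`, then `f` stays nonpositive once it is. -/
theorem nonpos_of_nonpos_of_hasDerivAt_neg {f f' : ℝ → ℝ}
    (hf : ∀ r > (0 : ℝ), HasDerivAt f (f' r) r)
    (hneg : ∀ r > (0 : ℝ), f r = 0 → f' r < 0) {s r : ℝ} (hs : 0 < s) (hsr : s ≤ r)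
    (hfs : f s ≤ 0) : f r ≤ 0 := by
  refine image_le_of_deriv_right_lt_deriv_boundary (f := f) (f' := f') (B := fun _ => 0)
    (B' := fun _ => 0) (a := s) (b := r) ?_ ?_ hfs ?_ ?_ ⟨hsr, le_rfl⟩
  · exact fun x hx => (hf x (hs.trans_le hx.1)).continuousAt.continuousWithinAt
  · exact fun x hx => (hf x (hs.trans_le hx.1)).hasDerivWithinAt
  · exact fun x => hasDerivAt_const x 0
  · exact fun x hx h => hneg x (hs.trans_le hx.1) h

/-- A function whose derivative has the sign of `E`, where `E` is strictly decreasing at its zeros,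
satisfies the Λ-property. -/
theorem LambdaProperty.of_deriv_eq_mul {G w E E' : ℝ → ℝ}
    (hw : ∀ r > (0 : ℝ), 0 < w r) (hG : ∀ r > (0 : ℝ), deriv G r = w r * E r)
    (hE : ∀ r > (0 : ℝ), HasDerivAt E (E' r) r)
    (hneg : ∀ r > (0 : ℝ), E r = 0 → E' r < 0) : LambdaProperty G := by
  have hle : ∀ r > (0 : ℝ), deriv G r ≤ 0 ↔ E r ≤ 0 := fun r hr => by
    rw [hG r hr]
    exact ⟨fun h => by by_contra! h'; exact absurd (mul_pos (hw r hr) h') h.not_gt,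
      fun h => mul_nonpos_of_nonneg_of_nonpos (hw r hr).le h⟩
  constructor
  · by_cases hall : ∀ r, 0 < r → 0 ≤ deriv G r
    · exact Or.inr hall
    left
    push Not at hall
    obtain ⟨t, ht, hGt⟩ := hall
    set S : Set ℝ := {r | 0 < r ∧ deriv G r ≤ 0} with hS
    have hne : S.Nonempty := ⟨t, ht, hGt.le⟩
    have hbdd : BddBelow S := ⟨0, fun x hx => hx.1.le⟩
    refine ⟨sInf S, le_csInf hne fun x hx => hx.1.le, fun r hr hlt => ?_, fun r hlt => ?_⟩
    · by_contra! h
      exact absurd (csInf_le hbdd (show r ∈ S from ⟨hr, h.le⟩)) hlt.not_ge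
    · obtain ⟨s, ⟨hs, hGs⟩, hsr⟩ := exists_lt_of_csInf_lt hne hlt
      exact (hle r (hs.trans hsr)).2
        (nonpos_of_nonpos_of_hasDerivAt_neg hE hneg hs hsr.le ((hle s hs).1 hGs))
  · intro hzero
    have hE0 : ∀ r > (0 : ℝ), E r = 0 := fun r hr => by
      have := hzero r hr
      rw [hG r hr] at this
      exact (mul_eq_zero.1 this).resolve_left (hw r hr).ne'
    have hev : E =ᶠ[𝓝 1] fun _ => 0 := by
      filter_upwards [Ioi_mem_nhds one_pos] with r hr using hE0 r hr
    have h0 : E' 1 = 0 :=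
      (hE 1 one_pos).unique ((hasDerivAt_const (1 : ℝ) (0 : ℝ)).congr_of_eventuallyEq hev)
    exact absurd h0 (hneg 1 one_pos (hE0 1 one_pos)).ne

/-- Under (H1), `ψ'² - 2ψψ'' → 1` as `r → 0⁺`. -/
theorem H1.tendsto_sq_deriv_sub {ψ : ℝ → ℝ} (h1 : H1 ψ) :
    Tendsto (fun r => deriv ψ r ^ 2 - 2 * ψ r * deriv (deriv ψ) r) (𝓝[>] 0) (𝓝 1) := by
  obtain ⟨hC, h0, hd, -, -⟩ := h1
  have hu : UniqueDiffOn ℝ (Ici (0 : ℝ)) := uniqueDiffOn_Ici 0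
  have hC1 : ContDiffOn ℝ 1 (derivWithin ψ (Ici 0)) (Ici 0) :=
    hC.derivWithin hu (by norm_num)
  have hC0 : ContDiffOn ℝ 0 (derivWithin (derivWithin ψ (Ici 0)) (Ici 0)) (Ici 0) :=
    hC1.derivWithin hu (by norm_num)
  have hd0 : derivWithin ψ (Ici 0) 0 = 1 := by
    have : DifferentiableAt ℝ ψ 0 := differentiableAt_of_deriv_ne_zero (by rw [hd]; norm_num)
    rw [this.derivWithin (hu 0 self_mem_Ici), hd]
  have hcont : ContinuousWithinAt (fun r => derivWithin ψ (Ici 0) r ^ 2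
      - 2 * ψ r * derivWithin (derivWithin ψ (Ici 0)) (Ici 0) r) (Ici 0) 0 :=
    ((hC1.continuousOn 0 self_mem_Ici).pow 2).sub
      ((continuousWithinAt_const.mul (hC.continuousOn 0 self_mem_Ici)).mul
        (hC0.continuousOn 0 self_mem_Ici))
  have hlim := hcont.tendsto.mono_left (nhdsWithin_mono 0 Ioi_subset_Ici_self)
  simp only [h0, hd0, one_pow, mul_zero, zero_mul, sub_zero] at hlim
  have hderiv : ∀ (f : ℝ → ℝ), ∀ r > (0 : ℝ), derivWithin f (Ici 0) r = deriv f r :=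
    fun f r hr => derivWithin_of_mem_nhds (Ici_mem_nhds hr)
  refine hlim.congr' ?_
  filter_upwards [self_mem_nhdsWithin] with r hr
  have hev : derivWithin ψ (Ici 0) =ᶠ[𝓝 r] deriv ψ := by
    filter_upwards [Ioi_mem_nhds hr] with x hx using hderiv ψ x hx
  rw [hderiv _ r hr, hderiv _ r hr, hev.deriv_eq]

/-- If `k = ψ'/ψ'''` is nonincreasing, then `ψ'² + ψ²/k - 2ψψ''` is positive on `(0, ∞)`. -/
theorem H1.sq_deriv_add_pos {ψ ψ₃ k k' : ℝ → ℝ} (h1 : H1 ψ)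
    (hd1 : ∀ r > (0 : ℝ), HasDerivAt ψ (deriv ψ r) r)
    (hd2 : ∀ r > (0 : ℝ), HasDerivAt (deriv ψ) (deriv (deriv ψ) r) r)
    (hd3 : ∀ r > (0 : ℝ), HasDerivAt (deriv (deriv ψ)) (ψ₃ r) r)
    (hk : ∀ r > (0 : ℝ), HasDerivAt k (k' r) r) (hkpos : ∀ r > (0 : ℝ), 0 < k r)
    (hk' : ∀ r > (0 : ℝ), k' r ≤ 0) (hψk : ∀ r > (0 : ℝ), deriv ψ r = k r * ψ₃ r)
    {r : ℝ} (hr : 0 < r) :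
    0 < deriv ψ r ^ 2 + ψ r ^ 2 / k r - 2 * ψ r * deriv (deriv ψ) r := by
  set D : ℝ → ℝ := fun r => deriv ψ r ^ 2 + ψ r ^ 2 / k r - 2 * ψ r * deriv (deriv ψ) r with hD
  have hDd : ∀ x > (0 : ℝ), HasDerivAt D (-k' x * ψ x ^ 2 / k x ^ 2) x := by
    intro x hx
    have hkx := (hkpos x hx).ne'
    have h := (((hd2 x hx).pow 2).add (((hd1 x hx).pow 2).div (hk x hx) hkx)).sub
      (((hd1 x hx).const_mul 2).mul (hd3 x hx))
    refine h.congr_deriv ?_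
    simp only [Pi.pow_apply]
    rw [hψk x hx]
    field_simp
    ring
  have hmono : MonotoneOn D (Ioi 0) := by
    refine monotoneOn_of_hasDerivWithinAt_nonneg (f' := fun x => -k' x * ψ x ^ 2 / k x ^ 2)
      (convex_Ioi 0)
      (fun x hx => (hDd x hx).continuousAt.continuousWithinAt) (fun x hx => ?_) (fun x hx => ?_)
    · rw [interior_Ioi] at hx
      exact (hDd x hx).hasDerivWithinAt
    · rw [interior_Ioi] at hx
      have := hk' x hx
      have : 0 ≤ -k' x := by linarith
      positivity
  have hev := (h1.tendsto_sq_deriv_sub.eventually (lt_mem_nhds one_pos)).and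
    (Ioo_mem_nhdsGT hr)
  obtain ⟨s, hs, hs0, hsr⟩ := hev.exists
  have hks := hkpos s hs0
  have hDs : 0 < D s := by
    have : 0 ≤ ψ s ^ 2 / k s := by positivity
    simp only [hD]
    linarith
  exact hDs.trans_le (hmono hs0 hr hsr.le)

/-- Numerical facts about the coefficients of `G'` in the range of exponents considered. -/
theorem delta_bounds {n : ℕ} (hn : 3 ≤ n) {p : ℝ}
    (hp : (2 * (n : ℝ) + 1) / (2 * (n : ℝ) - 3) ≤ p) (hp' : p < ((n : ℝ) + 2) / ((n : ℝ) - 2)) :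
    0 < delta n p ∧ 0 < (delta n p * (p - 1) - 2) * (delta n p + 2 - n) ∧
      (delta n p * (p - 1) - 2) * (delta n p + 2 - n) <
        1 + ((delta n p * (p - 1) - 2) + 1 - 2 * (delta n p + 2 - n)) := by
  have hn' : (3 : ℝ) ≤ n := by exact_mod_cast hn
  have hp0 : 0 < p := lt_of_lt_of_le (div_pos (by linarith) (by linarith)) hp
  rw [div_le_iff₀ (by linarith)] at hp
  rw [lt_div_iff₀ (by linarith)] at hp'
  have hδ : delta n p * (p + 3) = 2 * (n - 1) := by
    unfold delta; field_simp
  have hα : delta n p * (p - 1) - 2 = -4 * (delta n p - (n - 2) / 2) := by linarith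
  have hlow : ((n : ℝ) - 2) / 2 < delta n p := by
    rw [delta, lt_div_iff₀ (by linarith)]; nlinarith
  have hup : delta n p ≤ ((n : ℝ) - 2) / 2 + 1 / 4 := by
    rw [delta, div_le_iff₀ (by linarith)]; nlinarith
  rw [hα]
  obtain ⟨ε, hε⟩ : ∃ ε, delta n p = ((n : ℝ) - 2) / 2 + ε := ⟨_, (add_sub_cancel _ _).symm⟩
  rw [hε] at hlow hup ⊢
  refine ⟨by linarith, ?_, ?_⟩
  · nlinarith [mul_pos (show 0 < ε by linarith) (show 0 < ((n : ℝ) - 2) / 2 - ε by linarith)]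
  · nlinarith [mul_nonneg (show 0 ≤ 1 / 4 - ε by linarith) (show 0 ≤ (n : ℝ) - 2 by linarith),
      sq_nonneg ε]

/-- If ψ is four times differentiable with ψ''' > 0 and (ψ'/ψ''')' ≤ 0 on (0,∞),
then G satisfies the Λ-property for every (2n+1)/(2n-3) ≤ p < (n+2)/(n-2). -/
theorem statement5 (n : ℕ) (hn : 3 ≤ n) (ψ : ℝ → ℝ)
    (h1 : H1 ψ) (h2 : H2 ψ) (h3 : H3 ψ)
    (hC4 : ContDiffOn ℝ 4 ψ (Ioi 0))
    (hψ''' : ∀ r > (0:ℝ), 0 < deriv^[3] ψ r)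
    (hratio : ∀ r > (0:ℝ), deriv (fun s => deriv ψ s / deriv^[3] ψ s) r ≤ 0) :
    ∀ p : ℝ, (2 * (n : ℝ) + 1) / (2 * (n : ℝ) - 3) ≤ p →
      p < ((n : ℝ) + 2) / ((n : ℝ) - 2) → LambdaProperty (Gfun n p ψ) := by
  intro p hp hp'
  have hψpos := h1.2.2.2.2
  have hC3 : ContDiffOn ℝ 3 (deriv ψ) (Ioi 0) := hC4.deriv_of_isOpen isOpen_Ioi (by norm_num)
  have hC2 : ContDiffOn ℝ 2 (deriv (deriv ψ)) (Ioi 0) :=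
    hC3.deriv_of_isOpen isOpen_Ioi (by norm_num)
  have hC1 : ContDiffOn ℝ 1 (deriv^[3] ψ) (Ioi 0) :=
    hC2.deriv_of_isOpen isOpen_Ioi (by norm_num)
  have hdiff : ∀ {f : ℝ → ℝ} {m : WithTop ℕ∞}, ContDiffOn ℝ m f (Ioi 0) → m ≠ 0 →
      ∀ r > (0 : ℝ), DifferentiableAt ℝ f r :=
    fun hf hm r hr => (hf.differentiableOn hm).differentiableAt (Ioi_mem_nhds hr)
  have hd1 : ∀ r > (0 : ℝ), HasDerivAt ψ (deriv ψ r) r :=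
    fun r hr => (hdiff hC4 (by norm_num) r hr).hasDerivAt
  have hd2 : ∀ r > (0 : ℝ), HasDerivAt (deriv ψ) (deriv (deriv ψ) r) r :=
    fun r hr => (hdiff hC3 (by norm_num) r hr).hasDerivAt
  have hd3 : ∀ r > (0 : ℝ), HasDerivAt (deriv (deriv ψ)) (deriv^[3] ψ r) r :=
    fun r hr => (hdiff hC2 (by norm_num) r hr).hasDerivAt
  set k : ℝ → ℝ := fun s => deriv ψ s / deriv^[3] ψ s with hkdef
  have hk : ∀ r > (0 : ℝ), HasDerivAt k (deriv k r) r := fun r hr =>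
    ((hd2 r hr).differentiableAt.div (hdiff hC1 (by norm_num) r hr) (hψ''' r hr).ne').hasDerivAt
  have hψk : ∀ r > (0 : ℝ), deriv ψ r = k r * deriv^[3] ψ r := fun r hr =>
    (div_mul_cancel₀ _ (hψ''' r hr).ne').symm
  have hanti : AntitoneOn k (Ioi 0) := by
    refine antitoneOn_of_deriv_nonpos (convex_Ioi 0)
      (fun x hx => (hk x hx).continuousAt.continuousWithinAt) ?_ ?_ <;> rw [interior_Ioi]
    · exact fun x hx => (hk x hx).differentiableAt.differentiableWithinAt
    · exact hratio
  have hknonneg : ∀ r > (0 : ℝ), 0 ≤ k r := fun r hr => div_nonneg (h2 r hr) (hψ''' r hr).le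
  have hkpos : ∀ r > (0 : ℝ), 0 < k r := by
    intro r hr
    refine (hknonneg r hr).lt_of_ne' fun h0 => ?_
    have hψ0 : ∀ s > r, deriv ψ s = 0 := fun s hs => by
      have hs0 := hr.trans hs
      have : k s = 0 := le_antisymm (h0 ▸ hanti hr hs0 (le_of_lt hs)) (hknonneg s hs0)
      rw [hψk s hs0, this, zero_mul]
    have hψ'' : ∀ s > r, deriv (deriv ψ) s = 0 := fun s hs => by
      have : deriv ψ =ᶠ[𝓝 s] fun _ => 0 := by
        filter_upwards [Ioi_mem_nhds hs] with x hx using hψ0 x hx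
      rw [this.deriv_eq, deriv_const]
    have hev : deriv (deriv ψ) =ᶠ[𝓝 (r + 1)] fun _ => 0 := by
      filter_upwards [Ioi_mem_nhds (lt_add_one r)] with x hx using hψ'' x hx
    have hz : deriv^[3] ψ (r + 1) = 0 := by
      change deriv (deriv (deriv ψ)) (r + 1) = 0
      rw [hev.deriv_eq, deriv_const]
    exact (hψ''' (r + 1) (by linarith)).ne' hz
  obtain ⟨hδ, hc₁, hc₁c⟩ := delta_bounds hn hp hp'
  set δ := delta n p with hδdef
  set α := δ * (p - 1) - 2 with hα
  set A := δ + 2 - (n : ℝ) with hA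
  refine LambdaProperty.of_deriv_eq_mul
    (w := fun r => δ * ψ r ^ (α - 1) * (ψ r ^ 2 * deriv^[3] ψ r))
    (E := fun r => k r * (α * A * deriv ψ r ^ 2
      - (α + 1 - 2 * A) * (ψ r * deriv (deriv ψ) r)) / ψ r ^ 2 - 1)
    (E' := fun r => deriv k r * (α * A * deriv ψ r ^ 2
        - (α + 1 - 2 * A) * (ψ r * deriv (deriv ψ) r)) / ψ r ^ 2
      + deriv ψ r / ψ r * (k r * (2 * (α * A) * (ψ r * deriv (deriv ψ) r - deriv ψ r ^ 2)
        + (α + 1 - 2 * A) * (ψ r * deriv (deriv ψ) r)) / ψ r ^ 2 - (α + 1 - 2 * A)))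
    ?_ ?_ ?_ ?_
  · intro r hr
    have := hψpos r hr
    have := hψ''' r hr
    positivity
  · intro r hr
    have hψr := hψpos r hr
    have h := ((((hd1 r hr).rpow_const (p := α) (Or.inl hψr.ne')).const_mul δ).mul
      ((((hd2 r hr).pow 2).const_mul A).sub ((hd3 r hr).mul (hd1 r hr))))
    have hG : deriv (Gfun n p ψ) r = _ := h.deriv
    rw [hG]
    have hpow : ψ r ^ α = ψ r ^ (α - 1) * ψ r := by
      rw [← rpow_add_one hψr.ne', sub_add_cancel]
    simp only [Pi.pow_apply, Pi.mul_apply, Pi.sub_apply]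
    rw [hpow, hψk r hr]
    field_simp
    ring
  · intro r hr
    have hψr := (hψpos r hr).ne'
    have h := (((hk r hr).mul ((((hd2 r hr).pow 2).const_mul (α * A)).sub
      (((hd1 r hr).mul (hd3 r hr)).const_mul (α + 1 - 2 * A)))).div
        ((hd1 r hr).pow 2) (pow_ne_zero 2 hψr)).sub_const 1
    refine h.congr_deriv ?_
    simp only [Pi.pow_apply, Pi.mul_apply, Pi.sub_apply]
    rw [hψk r hr]
    field_simp
    ring
  · intro r hr hE
    have hψr := hψpos r hr
    have hkr := hkpos r hr
    have hD := h1.sq_deriv_add_pos hd1 hd2 hd3 hk hkpos hratio hψk hr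
    have hψ' : 0 < deriv ψ r := by
      rw [hψk r hr]
      exact mul_pos hkr (hψ''' r hr)
    set x := deriv ψ r
    set y := deriv (deriv ψ) r
    have hF : k r * (α * A * x ^ 2 - (α + 1 - 2 * A) * (ψ r * y)) = ψ r ^ 2 := by
      have := sub_eq_zero.1 hE
      rwa [div_eq_one_iff_eq (by positivity)] at this
    have hFpos : 0 < α * A * x ^ 2 - (α + 1 - 2 * A) * (ψ r * y) :=
      pos_of_mul_pos_right (by rw [hF]; positivity) hkr.le
    have hfirst : deriv k r * (α * A * x ^ 2 - (α + 1 - 2 * A) * (ψ r * y)) / ψ r ^ 2 ≤ 0 :=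
      div_nonpos_of_nonpos_of_nonneg
        (mul_nonpos_of_nonpos_of_nonneg (hratio r hr) hFpos.le) (by positivity)
    have hD' : 0 < k r * x ^ 2 + ψ r ^ 2 - 2 * (k r * (ψ r * y)) := by
      have h := mul_pos hkr hD
      have heq : k r * (x ^ 2 + ψ r ^ 2 / k r - 2 * ψ r * y)
          = k r * x ^ 2 + ψ r ^ 2 - 2 * (k r * (ψ r * y)) := by
        field_simp
      rwa [heq] at h
    have hsecond : k r * (2 * (α * A) * (ψ r * y - x ^ 2) + (α + 1 - 2 * A) * (ψ r * y))
        / ψ r ^ 2 - (α + 1 - 2 * A) < 0 := by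
      rw [sub_neg, div_lt_iff₀ (by positivity)]
      nlinarith [mul_pos hc₁ hD', mul_pos (sub_pos.2 hc₁c) (pow_pos hψr 2)]
    have := mul_neg_of_pos_of_neg (div_pos hψ' hψr) hsecond
    exact add_neg_of_nonpos_of_neg hfirst this
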